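/- arXiv:1702.01666 — 2 statements merged into one kernel-verified Lean document; each statement's English description precedes it below -/
import Mathlib

section
/- For every integer α ≥ 2, all constants c₁, c₂ > 0 and every δ ∈ (0,1/2), there exists a constant C > 0 (depending only on α, c₁, c₂, δ) such that for every alphabet size k ≥ 2, every distribution q on A = {1,…,k} satisfying c₁/k ≤ q_i ≤ c₂/k for all i, and every n ≥ C · k^{(α−1)/α}, there exists a function f : A^n → ℝ that is a (δ, 1/3)-estimator of D_α(·‖q) on the set of all distributions on A. -/
open Finset Real

/-- `p` is a probability distribution on `Fin k`. -/
def IsDist {k : ℕ} (p : Fin k → ℝ) : Prop := (∀ i, 0 ≤ p i) ∧ ∑ i, p i = 1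

/-- Rényi divergence of order `α` of `p` from `q`. -/
noncomputable def renyiDiv {k : ℕ} (α : ℝ) (p q : Fin k → ℝ) : ℝ :=
  (1 / (α - 1)) * Real.log (∑ i, p i ^ α * q i ^ (1 - α))

/-- Probability, under `n` i.i.d. samples from `p`, of the event `E`. -/
noncomputable def iidProb {k : ℕ} (n : ℕ) (p : Fin k → ℝ)
    (E : Set (Fin n → Fin k)) : ℝ :=
  ∑ x : Fin n → Fin k, Set.indicator E (fun y => ∏ j, p (y j)) x

/-- `f` is a `(δ, ε)`-estimator of the Rényi `α`-divergence to `q`,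
on the set of all distributions on `Fin k`. -/
def IsEstimator {k : ℕ} (n : ℕ) (α δ ε : ℝ) (q : Fin k → ℝ)
    (f : (Fin n → Fin k) → ℝ) : Prop :=
  ∀ p : Fin k → ℝ, IsDist p →
    iidProb n p {x | δ < |f x - renyiDiv α p q|} < ε

/-- expectation -/
noncomputable def EE {k : ℕ} (n : ℕ) (p : Fin k → ℝ) (g : (Fin n → Fin k) → ℝ) : ℝ :=
  ∑ x : Fin n → Fin k, (∏ j, p (x j)) * g x

/-- indicator that all of the samples in `A` equal `i` -/
noncomputable def II {k n : ℕ} (A : Finset (Fin n)) (i : Fin k) (x : Fin n → Fin k) : ℝ :=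
  ∏ j, if j ∈ A then (if x j = i then (1:ℝ) else 0) else 1

theorem EE_prod {k n : ℕ} (p : Fin k → ℝ) (F : Fin n → Fin k → ℝ) :
    EE n p (fun x => ∏ j, F j (x j)) = ∏ j, ∑ a, p a * F j a := by
  rw [Finset.prod_univ_sum]
  simp [EE, Fintype.piFinset_univ, Finset.prod_mul_distrib]

theorem EE_II {k n : ℕ} (p : Fin k → ℝ) (hp : IsDist p) (A : Finset (Fin n)) (i : Fin k) :
    EE n p (II A i) = p i ^ A.card := by
  have h := EE_prod p (fun (j : Fin n) (a : Fin k) => if j ∈ A then (if a = i then (1:ℝ) else 0) else 1)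
  have h2 : ∀ j : Fin n, ∑ a, p a * (if j ∈ A then (if a = i then (1:ℝ) else 0) else 1)
      = if j ∈ A then p i else 1 := by
    intro j
    split_ifs <;> simp [hp.2]
  simp only [h2] at h
  unfold II
  rw [h]
  simp [Finset.prod_ite]

theorem EE_II_disj {k n : ℕ} (p : Fin k → ℝ) (hp : IsDist p) (A B : Finset (Fin n))
    (hAB : Disjoint A B) (i l : Fin k) :
    EE n p (fun x => II A i x * II B l x) = p i ^ A.card * p l ^ B.card := by
  have h := EE_prod p (fun (j : Fin n) (a : Fin k) =>
    (if j ∈ A then (if a = i then (1:ℝ) else 0) else 1) *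
    (if j ∈ B then (if a = l then (1:ℝ) else 0) else 1))
  have h2 : ∀ j : Fin n, ∑ a, p a * ((if j ∈ A then (if a = i then (1:ℝ) else 0) else 1) *
    (if j ∈ B then (if a = l then (1:ℝ) else 0) else 1))
      = (if j ∈ A then p i else 1) * (if j ∈ B then p l else 1) := by
    intro j
    by_cases hA : j ∈ A <;> by_cases hB : j ∈ B
    · exact absurd hB (Finset.disjoint_left.1 hAB hA)
    all_goals simp [hA, hB, hp.2]
  simp only [h2, Finset.prod_mul_distrib] at h
  unfold II
  rw [h]
  simp [Finset.prod_ite]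

theorem EE_II_ne {k n : ℕ} (p : Fin k → ℝ) (A B : Finset (Fin n))
    (hAB : ¬ Disjoint A B) (i l : Fin k) (hil : i ≠ l) :
    EE n p (fun x => II A i x * II B l x) = 0 := by
  obtain ⟨j, hA, hB⟩ := Finset.not_disjoint_iff.1 hAB
  unfold EE
  refine Finset.sum_eq_zero fun x _ => ?_
  by_cases hx : x j = i
  · have : II B l x = 0 := Finset.prod_eq_zero (Finset.mem_univ j) (by simp [hB, hx, hil])
    simp [this]
  · have : II A i x = 0 := Finset.prod_eq_zero (Finset.mem_univ j) (by simp [hA, hx])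
    simp [this]

theorem EE_II_eq {k n : ℕ} (p : Fin k → ℝ) (hp : IsDist p) (A B : Finset (Fin n)) (i : Fin k) :
    EE n p (fun x => II A i x * II B i x) = p i ^ (A ∪ B).card := by
  rw [← EE_II p hp]
  congr 1
  ext x
  unfold II
  rw [← Finset.prod_mul_distrib]
  refine Finset.prod_congr rfl fun j _ => ?_
  by_cases hA : j ∈ A <;> by_cases hB : j ∈ B <;> simp [hA, hB]

/-- the U-statistic -/
noncomputable def TT {k : ℕ} (α n : ℕ) (w : Fin k → ℝ) (x : Fin n → Fin k) : ℝ :=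
  ∑ A ∈ Finset.powersetCard α (Finset.univ : Finset (Fin n)), ∑ i, w i * II A i x

theorem EE_sum {k n : ℕ} {ι : Type*} (p : Fin k → ℝ) (s : Finset ι) (c : ι → ℝ)
    (g : ι → (Fin n → Fin k) → ℝ) :
    EE n p (fun x => ∑ a ∈ s, c a * g a x) = ∑ a ∈ s, c a * EE n p (g a) := by
  unfold EE
  simp only [Finset.mul_sum]
  rw [Finset.sum_comm]
  refine Finset.sum_congr rfl fun a _ => Finset.sum_congr rfl fun x _ => by ring

theorem EE_TT {k n : ℕ} (α : ℕ) (w p : Fin k → ℝ) (hp : IsDist p) :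
    EE n p (TT α n w) = (n.choose α : ℝ) * ∑ i, w i * p i ^ α := by
  have : TT α n w = fun x => ∑ A ∈ Finset.powersetCard α (Finset.univ : Finset (Fin n)),
      1 * (fun x => ∑ i, w i * II A i x) x := by ext x; simp [TT]
  rw [this, EE_sum]
  have : ∀ A ∈ Finset.powersetCard α (Finset.univ : Finset (Fin n)),
      1 * EE n p (fun x => ∑ i, w i * II A i x) = ∑ i, w i * p i ^ α := by
    intro A hA
    rw [EE_sum, one_mul]
    simp only [EE_II p hp, (Finset.mem_powersetCard.1 hA).2]
  rw [Finset.sum_congr rfl this]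
  simp

theorem EE_pair {k n : ℕ} (w p : Fin k → ℝ) (A B : Finset (Fin n)) :
    EE n p (fun x => (∑ i, w i * II A i x) * (∑ l, w l * II B l x))
     = ∑ i, ∑ l, w i * w l * EE n p (fun x => II A i x * II B l x) := by
  have : (fun x : Fin n → Fin k => (∑ i, w i * II A i x) * (∑ l, w l * II B l x)) =
     fun x => ∑ z ∈ (Finset.univ ×ˢ Finset.univ : Finset (Fin k × Fin k)), (w z.1 * w z.2) *
      (fun x => II A z.1 x * II B z.2 x) x := by
    ext x
    rw [Finset.sum_mul_sum, Finset.sum_product]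
    refine Finset.sum_congr rfl fun a _ => Finset.sum_congr rfl fun x _ => by ring
  rw [this, EE_sum, Finset.sum_product]

theorem EE_TT_sq {k n : ℕ} (α : ℕ) (w p : Fin k → ℝ) (hp : IsDist p) (hw : ∀ i, 0 ≤ w i)
    (W t : ℝ) (hW : ∀ i, w i ≤ W) (ht : 0 ≤ t) (hpt : ∀ u, α ≤ u → ∑ i, p i ^ u ≤ t ^ u) :
    EE n p (fun x => TT α n w x ^ 2) ≤ ((n.choose α : ℝ) * ∑ i, w i * p i ^ α) ^ 2 +
      ∑ z ∈ (Finset.powersetCard α (Finset.univ : Finset (Fin n)) ×ˢ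
        Finset.powersetCard α (Finset.univ : Finset (Fin n))) with ¬ Disjoint z.1 z.2,
        W ^ 2 * t ^ (z.1 ∪ z.2).card := by
  set PP := Finset.powersetCard α (Finset.univ : Finset (Fin n)) with hPP
  have : (fun x => TT α n w x ^ 2) = fun x => ∑ z ∈ PP ×ˢ PP,
      1 * (fun x => (∑ i, w i * II z.1 i x) * (∑ l, w l * II z.2 l x)) x := by
    ext x
    rw [Finset.sum_product, sq, TT, Finset.sum_mul_sum]
    simp [hPP]
  rw [this, EE_sum, ← Finset.sum_filter_add_sum_filter_not _ (fun z => Disjoint z.1 z.2)]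
  simp only [EE_pair, one_mul]
  refine add_le_add ?_ (Finset.sum_le_sum ?_)
  · have : ∀ z ∈ (PP ×ˢ PP).filter (fun z => Disjoint z.1 z.2),
        ∑ i, ∑ l, w i * w l * EE n p (fun x => II z.1 i x * II z.2 l x)
         = (∑ i, w i * p i ^ α) ^ 2 := by
      intro z hz
      simp only [Finset.mem_filter, Finset.mem_product, hPP, Finset.mem_powersetCard] at hz
      simp only [EE_II_disj p hp _ _ hz.2, hz.1.1.2, hz.1.2.2]
      rw [sq, Finset.sum_mul_sum]
      refine Finset.sum_congr rfl fun a _ => Finset.sum_congr rfl fun x _ => by ring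
    rw [Finset.sum_congr rfl this, Finset.sum_const, nsmul_eq_mul, mul_pow]
    gcongr
    calc _ ≤ (((PP ×ˢ PP).card : ℕ) : ℝ) := by exact_mod_cast Finset.card_filter_le _ _
      _ = _ := by simp [hPP, sq]
  · intro z hz
    simp only [Finset.mem_filter, Finset.mem_product, hPP, Finset.mem_powersetCard] at hz
    have : ∀ i, ∑ l, w i * w l * EE n p (fun x => II z.1 i x * II z.2 l x)
        = w i * w i * p i ^ (z.1 ∪ z.2).card := by
      intro i
      rw [Finset.sum_eq_single i, EE_II_eq p hp]
      · intro l _ hl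
        rw [EE_II_ne p _ _ hz.2 _ _ hl.symm, mul_zero]
      · simp
    simp only [this]
    have hu : α ≤ (z.1 ∪ z.2).card := by
      rw [← hz.1.1.2]; exact Finset.card_le_card Finset.subset_union_left
    calc _ ≤ ∑ i, W ^ 2 * p i ^ (z.1 ∪ z.2).card := by
          refine Finset.sum_le_sum fun i _ => ?_
          have := hw i
          have := hp.1 i
          rw [sq]
          gcongr <;> first | exact hW i | exact (hw i).trans (hW i)
      _ = W ^ 2 * ∑ i, p i ^ (z.1 ∪ z.2).card := by rw [Finset.mul_sum]
      _ ≤ _ := by gcongr; exact hpt _ hu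

theorem count_pairs (α n : ℕ) (t : ℝ) (ht : 0 ≤ t) (hz : 1 ≤ n * t) :
    ∑ z ∈ (Finset.powersetCard α (Finset.univ : Finset (Fin n)) ×ˢ
        Finset.powersetCard α (Finset.univ : Finset (Fin n))) with ¬ Disjoint z.1 z.2,
        t ^ (z.1 ∪ z.2).card ≤ (2 * α) * 16 ^ α * (n * t) ^ (2 * α - 1) := by
  set Q := ((Finset.powersetCard α (Finset.univ : Finset (Fin n)) ×ˢ
        Finset.powersetCard α (Finset.univ : Finset (Fin n))).filter
          (fun z => ¬ Disjoint z.1 z.2)) with hQ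
  have hlt : ∀ z ∈ Q, (z.1 ∪ z.2).card ∈ Finset.range (2 * α) := by
    intro z hz
    simp only [hQ, Finset.mem_filter, Finset.mem_product, Finset.mem_powersetCard] at hz
    have h1 := Finset.card_union_add_card_inter z.1 z.2
    have h2 : 0 < (z.1 ∩ z.2).card := by
      rw [Finset.card_pos, ← Finset.not_disjoint_iff_nonempty_inter]; exact hz.2
    have := hz.1.1.2
    have := hz.1.2.2
    rw [Finset.mem_range]
    omega
  rw [← Finset.sum_fiberwise_of_maps_to hlt]
  have key : ∀ u ∈ Finset.range (2 * α), ∑ z ∈ Q with (z.1 ∪ z.2).card = u, t ^ (z.1 ∪ z.2).card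
      ≤ 16 ^ α * (n * t) ^ (2 * α - 1) := by
    intro u hu
    rw [Finset.mem_range] at hu
    have hc : (Q.filter (fun z => (z.1 ∪ z.2).card = u)).card ≤ n ^ u * 4 ^ u := by
      have hsub : Q.filter (fun z => (z.1 ∪ z.2).card = u) ⊆
          (Finset.powersetCard u (Finset.univ : Finset (Fin n))).biUnion
            (fun U => U.powerset ×ˢ U.powerset) := by
        intro z hz
        rw [Finset.mem_filter] at hz
        rw [Finset.mem_biUnion]
        refine ⟨z.1 ∪ z.2, by simp [Finset.mem_powersetCard, hz.2], ?_⟩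
        rw [Finset.mem_product, Finset.mem_powerset, Finset.mem_powerset]
        exact ⟨Finset.subset_union_left, Finset.subset_union_right⟩
      refine (Finset.card_le_card hsub).trans ?_
      refine (Finset.card_biUnion_le_card_mul _ _ (4 ^ u) ?_).trans ?_
      · intro U hU
        rw [Finset.mem_powersetCard] at hU
        rw [Finset.card_product, Finset.card_powerset, hU.2, ← mul_pow]
        norm_num
      · gcongr
        rw [Finset.card_powersetCard, Finset.card_univ, Fintype.card_fin]
        exact Nat.choose_le_pow _ _
    calc _ = ∑ z ∈ Q with (z.1 ∪ z.2).card = u, t ^ u := by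
          refine Finset.sum_congr rfl fun z hz => ?_
          rw [(Finset.mem_filter.1 hz).2]
      _ = ((Q.filter (fun z => (z.1 ∪ z.2).card = u)).card : ℝ) * t ^ u := by simp
      _ ≤ ((n:ℝ) ^ u * 4 ^ u) * t ^ u := by gcongr; exact_mod_cast hc
      _ = 4 ^ u * (n * t) ^ u := by rw [mul_pow]; ring
      _ ≤ 4 ^ (2 * α) * (n * t) ^ (2 * α - 1) := by
          gcongr
          · norm_num
          · omega
      _ = _ := by rw [pow_mul]; norm_num
  refine (Finset.sum_le_sum key).trans ?_
  simp [mul_assoc]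

theorem cheb {k n : ℕ} (p : Fin k → ℝ) (hp : IsDist p) (g : (Fin n → Fin k) → ℝ) (m ε V : ℝ)
    (hε : 0 < ε) (hm : EE n p g = m) (hV : EE n p (fun x => g x ^ 2) ≤ m ^ 2 + V)
    (E : Set (Fin n → Fin k)) (hE : ∀ x ∈ E, ε ≤ |g x - m|) :
    iidProb n p E ≤ V / ε ^ 2 := by
  have h1 : EE n p (fun _ => 1) = 1 := by
    have := EE_prod p (fun (_ : Fin n) (_ : Fin k) => (1:ℝ))
    simpa [hp.2] using this
  have hvar : EE n p (fun x => (g x - m) ^ 2) ≤ V := by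
    have : EE n p (fun x => (g x - m) ^ 2) =
        EE n p (fun x => g x ^ 2) - 2 * m * EE n p g + m ^ 2 * EE n p (fun _ => 1) := by
      unfold EE
      rw [Finset.mul_sum, Finset.mul_sum, ← Finset.sum_sub_distrib, ← Finset.sum_add_distrib]
      refine Finset.sum_congr rfl fun x _ => by ring
    rw [this, h1, hm]
    nlinarith
  rw [le_div_iff₀ (by positivity)]
  refine le_trans ?_ hvar
  unfold iidProb EE
  rw [Finset.sum_mul]
  refine Finset.sum_le_sum fun x _ => ?_
  have hpr : 0 ≤ ∏ j, p (x j) := Finset.prod_nonneg fun j _ => hp.1 _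
  by_cases hx : x ∈ E
  · rw [Set.indicator_of_mem hx]
    gcongr
    show ε ^ 2 ≤ (g x - m) ^ 2
    rw [← sq_abs (g x - m)]
    gcongr
    exact hE x hx
  · rw [Set.indicator_of_notMem hx, zero_mul]
    positivity

theorem log_close (δ s y : ℝ) (hs : 0 < s)
    (h : |y - s| < (1 - Real.exp (-δ)) * s) : |Real.log y - Real.log s| ≤ δ := by
  rw [abs_lt] at h
  have he := Real.exp_pos (-δ)
  have hy : Real.exp (-δ) * s < y := by linarith
  have hy0 : 0 < y := lt_trans (by positivity) hy
  have h1 := Real.add_one_le_exp (-δ)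
  have h2 := Real.add_one_le_exp δ
  rw [abs_le]
  constructor
  · have := Real.log_le_log (by positivity) hy.le
    rw [Real.log_mul he.ne' hs.ne', Real.log_exp] at this
    linarith
  · have h3 : y ≤ Real.exp δ * s := by nlinarith
    have := Real.log_le_log hy0 h3
    rw [Real.log_mul (Real.exp_pos δ).ne' hs.ne', Real.log_exp] at this
    linarith

theorem norm_facts {k : ℕ} (α : ℕ) (hα : 2 ≤ α) (hk : 2 ≤ k) (p : Fin k → ℝ) (hp : IsDist p) :
    ∃ t : ℝ, 0 < t ∧ ∑ i, p i ^ α = t ^ α ∧ (∀ u, α ≤ u → ∑ i, p i ^ u ≤ t ^ u) ∧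
      1 ≤ (k : ℝ) ^ (((α : ℝ) - 1) / (α : ℝ)) * t := by
  have hk0 : (0:ℝ) < k := by positivity
  have hα0 : α ≠ 0 := by omega
  have hP : 1 / (k:ℝ) ^ (α - 1) ≤ ∑ i, p i ^ α := by
    have := pow_sum_div_card_le_sum_pow (s := (Finset.univ : Finset (Fin k))) (f := p)
      (fun i _ => hp.1 i) (α - 1)
    rw [show α - 1 + 1 = α by omega, hp.2] at this
    simpa using this
  have hPpos : 0 < ∑ i, p i ^ α := lt_of_lt_of_le (by positivity) hP
  set t := (∑ i, p i ^ α) ^ ((α:ℝ)⁻¹) with ht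
  have htp : 0 < t := Real.rpow_pos_of_pos hPpos _
  have htα : t ^ α = ∑ i, p i ^ α := Real.rpow_inv_natCast_pow hPpos.le hα0
  refine ⟨t, htp, htα.symm, ?_, ?_⟩
  · intro u hu
    have hpt : ∀ i, p i ≤ t := by
      intro i
      refine le_of_pow_le_pow_left₀ hα0 htp.le ?_
      rw [htα]
      exact Finset.single_le_sum (f := fun i => p i ^ α) (fun i _ => pow_nonneg (hp.1 i) _) (Finset.mem_univ i)
    calc ∑ i, p i ^ u ≤ ∑ i, p i ^ α * t ^ (u - α) := by
          refine Finset.sum_le_sum fun i _ => ?_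
          have := hp.1 i
          rw [← Nat.add_sub_cancel' hu, pow_add, Nat.add_sub_cancel' hu]
          gcongr
          exact hpt i
      _ = t ^ u := by rw [← Finset.sum_mul, ← htα, ← pow_add]; congr 1; omega
  · have hb : 0 ≤ (k : ℝ) ^ (((α : ℝ) - 1) / (α : ℝ)) * t := by positivity
    refine le_of_pow_le_pow_left₀ hα0 hb ?_
    rw [one_pow, mul_pow, htα, ← Real.rpow_natCast, ← Real.rpow_mul hk0.le,
      div_mul_cancel₀ _ (by exact_mod_cast hα0)]
    have : (k:ℝ) ^ ((α:ℝ) - 1) = (k:ℝ) ^ (α - 1) := by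
      rw [← Real.rpow_natCast, Nat.cast_sub (by omega)]; simp
    rw [this]
    rw [div_le_iff₀ (by positivity)] at hP
    linarith

theorem choose_lower (α n : ℕ) (h : 2 * α ≤ n) :
    (n : ℝ) ^ α / (2 ^ α * (α.factorial : ℝ)) ≤ (n.choose α : ℝ) := by
  refine le_trans ?_ (Nat.pow_le_choose α n)
  rw [← div_div, ← div_pow]
  gcongr
  rw [Nat.cast_sub (by omega)]
  push_cast
  have : (2 * α : ℝ) ≤ n := by exact_mod_cast h
  linarith

/-- sublinear sample complexity for almost uniform
reference distributions. -/
theorem sublinear_complexity_almost_uniform :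
    ∀ α : ℕ, 2 ≤ α → ∀ c₁ c₂ : ℝ, 0 < c₁ → 0 < c₂ →
    ∀ δ : ℝ, δ ∈ Set.Ioo (0 : ℝ) (1/2) →
    ∃ C : ℝ, 0 < C ∧
      ∀ k : ℕ, 2 ≤ k →
      ∀ q : Fin k → ℝ, IsDist q → (∀ i, c₁ / k ≤ q i ∧ q i ≤ c₂ / k) →
      ∀ n : ℕ, C * (k : ℝ) ^ (((α : ℝ) - 1) / (α : ℝ)) ≤ (n : ℝ) →
      ∃ f : (Fin n → Fin k) → ℝ, IsEstimator n (α : ℝ) δ (1/3) q f := by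
  intro α hα c₁ c₂ hc₁ hc₂ δ hδ
  obtain ⟨hδ0, hδ1⟩ := hδ
  have hη : 0 < 1 - Real.exp (-δ) := by
    have : Real.exp (-δ) < 1 := by rw [Real.exp_lt_one_iff]; linarith
    linarith
  set η := 1 - Real.exp (-δ) with hηdef
  set R : ℝ := (c₁ / c₂) ^ (1 - (α:ℝ)) with hR
  have hRpos : 0 < R := by positivity
  set F : ℝ := 2 ^ α * (α.factorial : ℝ) with hF
  have hFpos : 0 < F := by positivity
  have hαpos : (0:ℝ) < α := by exact_mod_cast (by omega : 0 < α)
  have hα2 : (2:ℝ) ≤ α := by exact_mod_cast hα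
  set K : ℝ := R ^ 2 * ((2 * α) * 16 ^ α) * F ^ 2 / η ^ 2 with hK
  have hKpos : 0 < K := by positivity
  refine ⟨4 * K + 2 * α + 1, by positivity, ?_⟩
  intro k hk q hq hqb n hn
  set e : ℝ := (k : ℝ) ^ (((α : ℝ) - 1) / (α : ℝ)) with he
  have hk0 : (0:ℝ) < k := by exact_mod_cast (by omega : 0 < k)
  have hk1 : (1:ℝ) ≤ k := by exact_mod_cast (by omega : 1 ≤ k)
  have he1 : 1 ≤ e := Real.one_le_rpow hk1 (div_nonneg (by linarith) hαpos.le)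
  have hn2 : 2 * α ≤ n := by
    have : (2 * α : ℝ) ≤ n := by nlinarith
    exact_mod_cast this
  set w : Fin k → ℝ := fun i => q i ^ (1 - (α:ℝ)) with hw
  set w0 : ℝ := (c₂ / k) ^ (1 - (α:ℝ)) with hw0
  have hw0pos : 0 < w0 := by positivity
  have hW : ∀ i, w i ≤ R * w0 := by
    intro i
    have : R * w0 = (c₁ / k) ^ (1 - (α:ℝ)) := by
      rw [hR, hw0, ← Real.mul_rpow (by positivity) (by positivity)]
      congr 1
      field_simp
    rw [this]
    exact Real.rpow_le_rpow_of_nonpos (by positivity) (hqb i).1 (by linarith)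
  have hqpos : ∀ i, 0 < q i := fun i => lt_of_lt_of_le (by positivity) (hqb i).1
  have hwl : ∀ i, w0 ≤ w i := fun i =>
    Real.rpow_le_rpow_of_nonpos (hqpos i) (hqb i).2 (by linarith)
  have hwpos : ∀ i, 0 ≤ w i := fun i => hw0pos.le.trans (hwl i)
  set N : ℝ := (n.choose α : ℝ) with hN
  have hNpos : 0 < N := by
    rw [hN]; exact_mod_cast Nat.choose_pos (by omega)
  refine ⟨fun x => (1 / ((α:ℝ) - 1)) * Real.log (TT α n w x / N), ?_⟩
  intro p hp
  obtain ⟨t, ht0, htα, htu, hkt⟩ := norm_facts α hα hk p hp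
  set S : ℝ := ∑ i, w i * p i ^ α with hS
  have hSl : w0 * t ^ α ≤ S := by
    rw [← htα, Finset.mul_sum]
    refine Finset.sum_le_sum fun i _ => ?_
    exact mul_le_mul_of_nonneg_right (hwl i) (pow_nonneg (hp.1 i) _)
  have hSpos : 0 < S := lt_of_lt_of_le (by positivity) hSl
  have hdiv : renyiDiv (α:ℝ) p q = (1 / ((α:ℝ) - 1)) * Real.log S := by
    unfold renyiDiv
    congr 2
    refine Finset.sum_congr rfl fun i _ => ?_
    rw [Real.rpow_natCast, mul_comm]
  have hz : 4 * K + 2 * α + 1 ≤ n * t := by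
    have h1 := mul_le_mul_of_nonneg_right hn ht0.le
    have h2 : (4 * K + 2 * α + 1) * 1 ≤ (4 * K + 2 * α + 1) * (e * t) := by gcongr
    linarith
  have hz1 : 1 ≤ n * t := by linarith
  have hcheb := cheb p hp (TT α n w) (N * S) (η * (N * S))
    ((R * w0) ^ 2 * ((2 * α) * 16 ^ α * (n * t) ^ (2 * α - 1))) (by positivity)
    (EE_TT α w p hp) (by
      refine (EE_TT_sq α w p hp hwpos (R * w0) t hW ht0.le htu).trans ?_
      rw [← Finset.mul_sum]
      gcongr
      exact count_pairs α n t ht0.le hz1)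
    {x | δ < |(1 / ((α:ℝ) - 1)) * Real.log (TT α n w x / N) - renyiDiv (α:ℝ) p q|} (by
      intro x hx
      by_contra! hcon
      rw [Set.mem_ofPred_eq, hdiv, ← mul_sub, abs_mul] at hx
      have hlog := log_close δ S (TT α n w x / N) hSpos (by
        rw [← hηdef]
        have : TT α n w x / N - S = (TT α n w x - N * S) / N := by field_simp
        rw [this, abs_div, abs_of_pos hNpos, div_lt_iff₀ hNpos]
        linarith)
      have h1 : |1 / ((α:ℝ) - 1)| ≤ 1 := by
        rw [abs_of_nonneg (div_nonneg zero_le_one (by linarith)), div_le_one (by linarith)]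
        linarith
      have := mul_le_mul h1 hlog (abs_nonneg _) zero_le_one
      linarith)
  refine lt_of_le_of_lt hcheb ?_
  set z : ℝ := n * t with hzdef
  have hzpos : 0 < z := by linarith
  have hm : z ^ α / F * w0 ≤ N * S := by
    have h1 := choose_lower α n hn2
    calc z ^ α / F * w0 = ((n:ℝ) ^ α / F) * (w0 * t ^ α) := by rw [hzdef, mul_pow]; ring
      _ ≤ N * S := by gcongr
  have hzz : z ^ (2 * α - 1) * z = z ^ α * z ^ α := by
    rw [← pow_succ, ← pow_add]; congr 1; omega
  calc _ ≤ ((R * w0) ^ 2 * ((2 * α) * 16 ^ α * z ^ (2 * α - 1))) /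
        (η * (z ^ α / F * w0)) ^ 2 := by gcongr
    _ = K / z := by
      rw [hK]
      field_simp
      linarith [hzz, sq (z ^ α)]
    _ < 1 / 3 := by
      rw [div_lt_div_iff₀ hzpos (by norm_num)]
      linarith
end

section
/- Fix a real α > 1. There exist constants δ₀ > 0 and c > 0, depending only on α, such that for every alphabet size k ≥ 2 and every distribution q on A = {1,…,k} with q_i > 0 for all i, any function f : A^n → ℝ that is a (δ₀, 1/3)-estimator of D_α(·‖q) on the set of all distributions on A must satisfy n ≥ c · √k. -/
open Finset Real

/-- sign of a Boolean -/
noncomputable def sg (b : Bool) : ℝ := if b then 1 else -1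

/-- perturbed distribution -/
noncomputable def pert {k : ℕ} (w s : Fin k → ℝ) (g : Fin k → Fin k) (η : ℝ)
    (e : Fin k → Bool) (a : Fin k) : ℝ := w a * (1 + η * (s a * sg (e (g a))))

/-- the power sum -/
noncomputable def psum {k : ℕ} (α : ℝ) (p q : Fin k → ℝ) : ℝ := ∑ i, p i ^ α * q i ^ (1 - α)

lemma psum_pos {k : ℕ} (α : ℝ) (p q : Fin k → ℝ) (hp : IsDist p) (hq : ∀ i, 0 < q i) :
    0 < psum α p q := by
  obtain ⟨h0, h1⟩ := hp
  have : ∃ a, 0 < p a := by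
    by_contra! h
    have : ∑ i, p i ≤ 0 := Finset.sum_nonpos fun i _ => h i
    linarith
  obtain ⟨a, ha⟩ := this
  refine Finset.sum_pos' (fun i _ => ?_) ⟨a, Finset.mem_univ _, ?_⟩
  · exact mul_nonneg (Real.rpow_nonneg (h0 i) _) (Real.rpow_nonneg (hq i).le _)
  · exact mul_pos (Real.rpow_pos_of_pos ha _) (Real.rpow_pos_of_pos (hq a) _)

lemma prob_total {k n : ℕ} (p : Fin k → ℝ) (hp : IsDist p) :
    ∑ x : Fin n → Fin k, ∏ j, p (x j) = 1 := by
  have := Fintype.sum_pow p n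
  rw [hp.2, one_pow] at this
  exact this.symm

lemma prob_nonneg {k n : ℕ} (p : Fin k → ℝ) (hp : IsDist p) (x : Fin n → Fin k) :
    0 ≤ ∏ j, p (x j) := Finset.prod_nonneg fun j _ => hp.1 _

lemma iidProb_mono {k n : ℕ} (p : Fin k → ℝ) (hp : IsDist p) {E F : Set (Fin n → Fin k)}
    (h : E ⊆ F) : iidProb n p E ≤ iidProb n p F := by
  unfold iidProb
  refine Finset.sum_le_sum fun x _ => ?_
  exact Set.indicator_le_indicator_of_subset h (fun y => prob_nonneg p hp y) x

lemma iidProb_compl {k n : ℕ} (p : Fin k → ℝ) (hp : IsDist p) (E : Set (Fin n → Fin k)) :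
    iidProb n p E + iidProb n p Eᶜ = 1 := by
  unfold iidProb
  rw [← Finset.sum_add_distrib, ← prob_total (n := n) p hp]
  refine Finset.sum_congr rfl fun x _ => ?_
  exact congrFun (Set.indicator_self_add_compl E (fun y => ∏ j, p (y j))) x

lemma iidProb_nonneg {k n : ℕ} (p : Fin k → ℝ) (hp : IsDist p) (E : Set (Fin n → Fin k)) :
    0 ≤ iidProb n p E :=
  Finset.sum_nonneg fun x _ => Set.indicator_nonneg (fun y _ => prob_nonneg p hp y) x

/-- parameters: everything needed about `w, s, g` -/
structure Good {k : ℕ} (w s : Fin k → ℝ) (g : Fin k → Fin k) (r : ℝ) : Prop where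
  dist : IsDist w
  sgn : ∀ a, s a = 1 ∨ s a = -1
  bal : ∀ i, ∑ a with g a = i, w a * s a = 0
  mass : ∀ i, ∑ a with g a = i, w a ≤ r

lemma sg_cases (b : Bool) : sg b = 1 ∨ sg b = -1 := by cases b <;> simp [sg]

lemma ss_cases {k : ℕ} {w s : Fin k → ℝ} {g : Fin k → Fin k} {r : ℝ} (h : Good w s g r)
    (e : Fin k → Bool) (a : Fin k) : s a * sg (e (g a)) = 1 ∨ s a * sg (e (g a)) = -1 := by
  rcases h.sgn a with h1 | h1 <;> rcases sg_cases (e (g a)) with h2 | h2 <;> simp [h1, h2]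

lemma factor_nonneg {k : ℕ} {w s : Fin k → ℝ} {g : Fin k → Fin k} {r : ℝ} (h : Good w s g r)
    (η : ℝ) (h0 : 0 ≤ η) (h1 : η ≤ 1) (e : Fin k → Bool) (a : Fin k) :
    0 ≤ 1 + η * (s a * sg (e (g a))) := by
  rcases ss_cases h e a with h2 | h2 <;> rw [h2] <;> linarith

lemma pert_dist {k : ℕ} {w s : Fin k → ℝ} {g : Fin k → Fin k} {r : ℝ} (h : Good w s g r)
    (η : ℝ) (h0 : 0 ≤ η) (h1 : η ≤ 1) (e : Fin k → Bool) : IsDist (pert w s g η e) := by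
  refine ⟨fun a => mul_nonneg (h.dist.1 a) (factor_nonneg h η h0 h1 e a), ?_⟩
  have key : ∑ a, w a * (s a * sg (e (g a))) = 0 := by
    rw [← Finset.sum_fiberwise Finset.univ g]
    refine Finset.sum_eq_zero fun i _ => ?_
    have : ∑ a with g a = i, w a * (s a * sg (e (g a)))
        = (∑ a with g a = i, w a * s a) * sg (e i) := by
      rw [Finset.sum_mul]
      refine Finset.sum_congr rfl fun a ha => ?_
      rw [(Finset.mem_filter.1 ha).2]; ring
    rw [this, h.bal i, zero_mul]
  have : ∑ a, pert w s g η e a = ∑ a, w a + η * ∑ a, w a * (s a * sg (e (g a))) := by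
    rw [Finset.mul_sum, ← Finset.sum_add_distrib]
    refine Finset.sum_congr rfl fun a _ => ?_
    unfold pert; ring
  rw [this, key, h.dist.2]; ring

/-- odd part -/
noncomputable def Tsum {k : ℕ} (α : ℝ) (w s q : Fin k → ℝ) (g : Fin k → Fin k)
    (e : Fin k → Bool) : ℝ := ∑ a, w a ^ α * q a ^ (1 - α) * (s a * sg (e (g a)))

lemma Tsum_not {k : ℕ} (α : ℝ) (w s q : Fin k → ℝ) (g : Fin k → Fin k)
    (e : Fin k → Bool) : Tsum α w s q g (fun i => !(e i)) = - Tsum α w s q g e := by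
  unfold Tsum
  rw [← Finset.sum_neg_distrib]
  refine Finset.sum_congr rfl fun a _ => ?_
  have : sg (!(e (g a))) = - sg (e (g a)) := by cases e (g a) <;> simp [sg]
  rw [this]; ring

lemma psum_pert {k : ℕ} {w s : Fin k → ℝ} {g : Fin k → Fin k} {r : ℝ} (h : Good w s g r)
    (α η : ℝ) (h0 : 0 ≤ η) (h1 : η ≤ 1) (q : Fin k → ℝ) (e : Fin k → Bool) :
    psum α (pert w s g η e) q
      = ((1 + η) ^ α + (1 - η) ^ α) / 2 * psum α w q
        + ((1 + η) ^ α - (1 - η) ^ α) / 2 * Tsum α w s q g e := by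
  unfold psum Tsum
  rw [Finset.mul_sum, Finset.mul_sum, ← Finset.sum_add_distrib]
  refine Finset.sum_congr rfl fun a _ => ?_
  unfold pert
  rw [Real.mul_rpow (h.dist.1 a) (factor_nonneg h η h0 h1 e a)]
  rcases ss_cases h e a with h2 | h2 <;> rw [h2]
  · rw [mul_one]; ring
  · rw [show 1 + η * (-1 : ℝ) = 1 - η by ring]; ring

lemma mix_eq {k n : ℕ} (s : Fin k → ℝ) (g : Fin k → Fin k) (η : ℝ) (x : Fin n → Fin k)
    (hx : Function.Injective (fun j => g (x j))) :
    ∑ e : Fin k → Bool, ∏ j, (1 + η * (s (x j) * sg (e (g (x j))))) = 2 ^ k := by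
  classical
  have h1 : ∀ e : Fin k → Bool, ∏ j, (1 + η * (s (x j) * sg (e (g (x j)))))
      = ∏ i : Fin k, ∏ j with g (x j) = i, (1 + η * (s (x j) * sg (e i))) := by
    intro e
    rw [← Finset.prod_fiberwise Finset.univ (fun j => g (x j))]
    refine Finset.prod_congr rfl fun i _ => Finset.prod_congr rfl fun j hj => ?_
    rw [(Finset.mem_filter.1 hj).2]
  simp_rw [h1]
  rw [← Fintype.prod_sum (fun (i : Fin k) (b : Bool) =>
    ∏ j with g (x j) = i, (1 + η * (s (x j) * sg b)))]
  have h2 : ∀ i : Fin k, ∑ b : Bool, ∏ j with g (x j) = i, (1 + η * (s (x j) * sg b)) = 2 := by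
    intro i
    by_cases hi : ∃ j, g (x j) = i
    · obtain ⟨j, hj⟩ := hi
      have : (Finset.univ.filter fun j => g (x j) = i) = {j} := by
        ext l
        simp only [Finset.mem_filter, Finset.mem_univ, true_and, Finset.mem_singleton]
        constructor
        · intro hl; exact hx (hl.trans hj.symm)
        · rintro rfl; exact hj
      rw [this]
      simp [sg]; ring
    · have : (Finset.univ.filter fun j => g (x j) = i) = ∅ := by
        ext l
        simp only [Finset.mem_filter, Finset.mem_univ, true_and, Finset.notMem_empty, iff_false]
        exact fun hl => hi ⟨l, hl⟩
      rw [this]; simp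
  rw [Finset.prod_congr rfl fun i _ => h2 i]
  simp

lemma pair_coll {k n : ℕ} {w s : Fin k → ℝ} {g : Fin k → Fin k} {r : ℝ} (h : Good w s g r)
    (j l : Fin n) (hjl : j ≠ l) :
    iidProb n w {x | g (x j) = g (x l)} ≤ r := by
  classical
  have h1 : iidProb n w {x | g (x j) = g (x l)} = ∑ i : Fin k, (∑ a with g a = i, w a) ^ 2 := by
    have : ∀ i : Fin k, (∑ a with g a = i, w a) ^ 2 = ∑ x : Fin n → Fin k,
        ∏ t, (if t = j ∨ t = l then (if g (x t) = i then w (x t) else 0) else w (x t)) := by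
      intro i
      rw [← Fintype.prod_sum (fun (t : Fin n) (a : Fin k) =>
        if t = j ∨ t = l then (if g a = i then w a else 0) else w a)]
      have h2 : ∀ t : Fin n, ∑ a, (if t = j ∨ t = l then (if g a = i then w a else 0) else w a)
          = if t = j ∨ t = l then (∑ a with g a = i, w a) else 1 := by
        intro t
        split_ifs
        · rw [Finset.sum_filter]
        · exact h.dist.2
      rw [Finset.prod_congr rfl fun t _ => h2 t, Finset.prod_ite]
      simp only [Finset.prod_const, one_pow, mul_one]
      have : (Finset.univ.filter fun t => t = j ∨ t = l) = {j, l} := by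
        ext t; simp
      rw [this, Finset.card_pair hjl]
    simp_rw [this]
    rw [Finset.sum_comm]
    unfold iidProb
    refine Finset.sum_congr rfl fun x _ => ?_
    have h3 : ∀ i : Fin k, ∏ t, (if t = j ∨ t = l then (if g (x t) = i then w (x t) else 0)
        else w (x t)) = if g (x j) = i ∧ g (x l) = i then ∏ t, w (x t) else 0 := by
      intro i
      split_ifs with hc
      · refine Finset.prod_congr rfl fun t _ => ?_
        split_ifs with h4 h5
        · rfl
        · rcases h4 with rfl | rfl
          · exact absurd hc.1 h5
          · exact absurd hc.2 h5
        · rfl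
      · rw [not_and_or] at hc
        rcases hc with hc | hc
        · exact Finset.prod_eq_zero (Finset.mem_univ j) (by simp [hc])
        · exact Finset.prod_eq_zero (Finset.mem_univ l) (by simp [hc])
    simp_rw [h3]
    by_cases hx : g (x j) = g (x l)
    · rw [Set.indicator_of_mem (by exact hx)]
      simp [hx]
    · rw [Set.indicator_of_notMem (by exact hx)]
      symm
      refine Finset.sum_eq_zero fun i _ => if_neg ?_
      rintro ⟨h5, h6⟩
      exact hx (h5.trans h6.symm)
  rw [h1]
  have h0 : ∀ i, 0 ≤ ∑ a with g a = i, w a := fun i => Finset.sum_nonneg fun a _ => h.dist.1 a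
  calc ∑ i : Fin k, (∑ a with g a = i, w a) ^ 2
      ≤ ∑ i : Fin k, r * (∑ a with g a = i, w a) := by
        refine Finset.sum_le_sum fun i _ => ?_
        rw [sq]
        exact mul_le_mul_of_nonneg_right (h.mass i) (h0 i)
    _ = r := by
        rw [← Finset.mul_sum, Finset.sum_fiberwise, h.dist.2, mul_one]

lemma coll {k n : ℕ} {w s : Fin k → ℝ} {g : Fin k → Fin k} {r : ℝ} (h : Good w s g r)
    (hr : 0 ≤ r) :
    iidProb n w {x | ¬ Function.Injective (fun j => g (x j))} ≤ (n : ℝ) ^ 2 * r := by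
  classical
  have h1 : iidProb n w {x | ¬ Function.Injective (fun j => g (x j))}
      ≤ ∑ j : Fin n, ∑ l : Fin n, if j = l then 0 else iidProb n w {x | g (x j) = g (x l)} := by
    have h2 : ∀ j l : Fin n, (if j = l then 0 else iidProb n w {x | g (x j) = g (x l)})
        = ∑ x : Fin n → Fin k, if j = l then 0 else
          Set.indicator {x | g (x j) = g (x l)} (fun y => ∏ j, w (y j)) x := by
      intro j l
      split_ifs <;> simp [iidProb]
    simp_rw [h2]
    have h3 : ∀ (j : Fin n), (∑ l : Fin n, ∑ x : Fin n → Fin k, if j = l then 0 else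
          Set.indicator {x | g (x j) = g (x l)} (fun y => ∏ j, w (y j)) x)
        = ∑ x : Fin n → Fin k, ∑ l : Fin n, if j = l then 0 else
          Set.indicator {x | g (x j) = g (x l)} (fun y => ∏ j, w (y j)) x :=
      fun j => Finset.sum_comm
    simp_rw [h3]
    rw [Finset.sum_comm]
    unfold iidProb
    refine Finset.sum_le_sum fun x _ => ?_
    have hnn : ∀ j l : Fin n, 0 ≤ if j = l then 0 else
          Set.indicator {x | g (x j) = g (x l)} (fun y => ∏ j, w (y j)) x := by
      intro j l
      split_ifs
      · exact le_rfl
      · exact Set.indicator_nonneg (fun y _ => prob_nonneg w h.dist y) x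
    by_cases hx : Function.Injective (fun j => g (x j))
    · rw [Set.indicator_of_notMem (by simpa using hx)]
      exact Finset.sum_nonneg fun j _ => Finset.sum_nonneg fun l _ => hnn j l
    · rw [Set.indicator_of_mem (by exact hx)]
      simp only [Function.Injective, not_forall] at hx
      obtain ⟨j, l, hjl, hne⟩ := hx
      refine le_trans ?_ (Finset.single_le_sum
        (fun j _ => Finset.sum_nonneg fun l _ => hnn j l) (Finset.mem_univ j))
      refine le_trans ?_ (Finset.single_le_sum (fun l _ => hnn j l) (Finset.mem_univ l))
      rw [if_neg hne, Set.indicator_of_mem (by exact hjl)]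
  refine h1.trans ?_
  calc _ ≤ ∑ j : Fin n, ∑ l : Fin n, r := by
        refine Finset.sum_le_sum fun j _ => Finset.sum_le_sum fun l _ => ?_
        split_ifs with hjl
        · exact hr
        · exact pair_coll h j l hjl
    _ = (n : ℝ) ^ 2 * r := by simp; ring

lemma mix_lower {k n : ℕ} {w s : Fin k → ℝ} {g : Fin k → Fin k} {r : ℝ} (h : Good w s g r)
    (hr : 0 ≤ r) (η : ℝ) (h0 : 0 ≤ η) (h1 : η ≤ 1) (E : Set (Fin n → Fin k)) :
    2 ^ k * (iidProb n w E - (n : ℝ) ^ 2 * r)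
      ≤ ∑ e : Fin k → Bool, iidProb n (pert w s g η e) E := by
  classical
  have hc := coll (n := n) h hr
  have h2 : iidProb n w E - (n : ℝ) ^ 2 * r ≤
      iidProb n w (E ∩ {x | Function.Injective (fun j => g (x j))}) := by
    have : iidProb n w E ≤ iidProb n w (E ∩ {x | Function.Injective (fun j => g (x j))})
        + iidProb n w {x | ¬ Function.Injective (fun j => g (x j))} := by
      unfold iidProb
      rw [← Finset.sum_add_distrib]
      refine Finset.sum_le_sum fun x _ => ?_
      have := prob_nonneg w h.dist x
      by_cases hE : x ∈ E <;> by_cases hx : Function.Injective (fun j => g (x j)) <;>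
        simp [Set.indicator, hE, hx, this]
    linarith
  refine (mul_le_mul_of_nonneg_left h2 (by positivity)).trans ?_
  unfold iidProb
  rw [Finset.sum_comm, Finset.mul_sum]
  refine Finset.sum_le_sum fun x _ => ?_
  by_cases hx : x ∈ E ∩ {x | Function.Injective (fun j => g (x j))}
  · rw [Set.indicator_of_mem hx]
    simp only [Set.indicator_of_mem hx.1]
    have : ∀ e : Fin k → Bool, ∏ j, pert w s g η e (x j)
        = (∏ j, w (x j)) * ∏ j, (1 + η * (s (x j) * sg (e (g (x j))))) := by
      intro e
      rw [← Finset.prod_mul_distrib]; rfl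
    simp_rw [this]
    rw [← Finset.mul_sum, mix_eq s g η x hx.2, mul_comm]
  · rw [Set.indicator_of_notMem hx, mul_zero]
    exact Finset.sum_nonneg fun e _ =>
      Set.indicator_nonneg (fun y _ => prob_nonneg _ (pert_dist h η h0 h1 e) y) x

lemma exists_good (k : ℕ) (hk : 2 ≤ k) :
    ∃ (w s : Fin k → ℝ) (g : Fin k → Fin k), Good w s g (3 / k) := by
  classical
  set m := k / 2 with hm
  have hm1 : 1 ≤ m := by omega
  have hmk : 2 * m ≤ k := by omega
  have hkm : k ≤ 3 * m := by omega
  have hmR : (0 : ℝ) < m := by exact_mod_cast hm1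
  refine ⟨fun a => if (a : ℕ) < 2 * m then 1 / (2 * m) else 0,
    fun a => if (a : ℕ) % 2 = 0 then 1 else -1,
    fun a => ⟨(a : ℕ) / 2, by omega⟩, ⟨⟨?_, ?_⟩, ?_, ?_, ?_⟩⟩
  · intro a; dsimp only; split_ifs
    · positivity
    · exact le_rfl
  · rw [Fin.sum_univ_eq_sum_range (fun a => if a < 2 * m then 1 / (2 * (m : ℝ)) else 0) k,
      ← Finset.sum_filter]
    have : (Finset.range k).filter (fun a => a < 2 * m) = Finset.range (2 * m) := by
      ext a; simp; omega
    rw [this]; simp; field_simp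
  · intro a; by_cases h : (a : ℕ) % 2 = 0 <;> simp [h]
  · intro i
    have hpl : ∀ a : Fin k, ∀ _ : (a : ℕ) < 2 * m, (if (a : ℕ) % 2 = 0 then (a : ℕ) + 1 else a - 1) < k := by
      intro a ha; split_ifs <;> omega
    refine Finset.sum_involution (fun a _ => if h : (a : ℕ) < 2 * m then ⟨_, hpl a h⟩ else a)
      ?_ ?_ ?_ ?_
    · intro a ha
      by_cases h : (a : ℕ) < 2 * m
      · by_cases h2 : (a : ℕ) % 2 = 0
        · have h3 : (a : ℕ) + 1 < 2 * m := by omega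
          have h4 : ((a : ℕ) + 1) % 2 ≠ 0 := by omega
          simp [h, h2, h3, h4]
        · have h3 : (a : ℕ) - 1 < 2 * m := by omega
          have h4 : ((a : ℕ) - 1) % 2 = 0 := by omega
          simp only [h, h2, h3, h4, dite_true, if_true, if_false]; ring
      · simp [h]
    · intro a ha hne
      by_cases h : (a : ℕ) < 2 * m
      · simp only [h, dite_true, ne_eq, Fin.ext_iff]
        split_ifs <;> omega
      · simp [h] at hne
    · intro a ha
      simp only [Finset.mem_filter, Finset.mem_univ, true_and, Fin.ext_iff] at ha ⊢
      rw [← ha]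
      by_cases h : (a : ℕ) < 2 * m
      · simp only [h, dite_true]
        split_ifs <;> omega
      · simp [h]
    · intro a ha
      by_cases h : (a : ℕ) < 2 * m
      · have h3 : (if (a : ℕ) % 2 = 0 then (a : ℕ) + 1 else a - 1) < 2 * m := by
          split_ifs <;> omega
        simp only [h, h3, dite_true, Fin.ext_iff]
        split_ifs <;> omega
      · simp [h]
  · intro i
    have hcard : (Finset.univ.filter fun a : Fin k => (⟨(a : ℕ) / 2, by omega⟩ : Fin k) = i).card ≤ 2 := by
      rw [← Finset.card_map Fin.valEmbedding]
      refine (Finset.card_le_card (t := {2 * (i : ℕ), 2 * (i : ℕ) + 1}) ?_).trans Finset.card_le_two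
      intro t ht
      simp only [Finset.mem_map, Finset.mem_filter, Finset.mem_univ, true_and, Fin.ext_iff,
        Fin.valEmbedding_apply] at ht
      obtain ⟨a, ha, rfl⟩ := ht
      simp only [Finset.mem_insert, Finset.mem_singleton]
      omega
    refine (Finset.sum_le_card_nsmul _ _ (1 / (2 * (m : ℝ))) ?_).trans ?_
    · intro a _
      split_ifs
      · exact le_rfl
      · positivity
    · rw [nsmul_eq_mul]
      have h2 : ((Finset.univ.filter fun a : Fin k => (⟨(a : ℕ) / 2, by omega⟩ : Fin k) = i).card : ℝ) ≤ 2 := by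
        exact_mod_cast hcard
      have hkR : (0 : ℝ) < k := by exact_mod_cast (by omega : 0 < k)
      have hkm' : (k : ℝ) ≤ 3 * m := by exact_mod_cast hkm
      calc _ ≤ 2 * (1 / (2 * (m : ℝ))) := mul_le_mul_of_nonneg_right h2 (by positivity)
        _ = 1 / m := by field_simp
        _ ≤ 3 / k := by rw [div_le_div_iff₀ hmR hkR]; linarith

/-- the coefficients -/
noncomputable def cC (α η : ℝ) : ℝ := ((1 + η) ^ α + (1 - η) ^ α) / 2
noncomputable def cD (α η : ℝ) : ℝ := ((1 + η) ^ α - (1 - η) ^ α) / 2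

lemma exists_kappa (α : ℝ) (hα : 1 < α) : ∃ κ : ℝ, 1 < κ ∧ κ < cC α 1 ∧ κ < cC α (1/2) ∧
    0 < cD α (1/2) ∧ cD α 1 = cC α 1 ∧
    cC α (1/2) - cD α (1/2) + cD α (1/2) * κ / cC α 1 < 1 / κ := by
  have hsc := strictConvexOn_rpow hα
  have e1 : (3/2 : ℝ) ^ α < (1 + 2 ^ α) / 2 := by
    have := hsc.2 (Set.mem_Ici.2 (zero_le_one : (0:ℝ) ≤ 1)) (Set.mem_Ici.2 (zero_le_two : (0:ℝ) ≤ 2)) (by norm_num)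
      (by norm_num : (0:ℝ) < 1/2) (by norm_num : (0:ℝ) < 1/2) (by norm_num)
    norm_num at this
    norm_num; linarith
  have e2 : (1/2 : ℝ) ^ α < 1 / 2 := by
    have := Real.rpow_lt_rpow_of_exponent_gt (x := 1/2) (by norm_num) (by norm_num) hα
    simpa using this
  have e3 : 1 < ((3/2 : ℝ) ^ α + (1/2) ^ α) / 2 := by
    have := hsc.2 (Set.mem_Ici.2 (by norm_num : (0:ℝ) ≤ 3/2)) (Set.mem_Ici.2 (by norm_num : (0:ℝ) ≤ 1/2)) (by norm_num)
      (by norm_num : (0:ℝ) < 1/2) (by norm_num : (0:ℝ) < 1/2) (by norm_num)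
    simp only [smul_eq_mul] at this
    rw [show (1/2 * (3/2) + 1/2 * (1/2) : ℝ) = 1 by norm_num, Real.one_rpow] at this
    linarith
  have e4 : (2 : ℝ) < 2 ^ α := by
    have := Real.rpow_lt_rpow_of_exponent_lt (x := 2) (by norm_num) hα
    simpa using this
  have hα0 : α ≠ 0 := by linarith
  have hC1 : cC α 1 = 2 ^ α / 2 := by
    unfold cC; rw [sub_self, Real.zero_rpow hα0]; norm_num
  have hD1 : cD α 1 = 2 ^ α / 2 := by
    unfold cD; rw [sub_self, Real.zero_rpow hα0]; norm_num
  have hC2 : cC α (1/2) = ((3/2) ^ α + (1/2) ^ α) / 2 := by unfold cC; norm_num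
  have hD2 : cD α (1/2) = ((3/2) ^ α - (1/2) ^ α) / 2 := by unfold cD; norm_num
  have hC1' : 1 < cC α 1 := by rw [hC1]; linarith
  have hDpos : 0 < cD α (1/2) := by rw [hD2]; linarith
  have key : cC α (1/2) - cD α (1/2) + cD α (1/2) * 1 / cC α 1 < 1 / 1 := by
    rw [hC1, hC2, hD2]
    have hp : (0:ℝ) < 2 ^ α := by linarith
    rw [← sub_pos]
    have : (1 / 1 - (((3/2 : ℝ) ^ α + (1/2) ^ α) / 2 - ((3/2) ^ α - (1/2) ^ α) / 2
      + ((3/2) ^ α - (1/2) ^ α) / 2 * 1 / (2 ^ α / 2)))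
      = (2 ^ α - 2 ^ α * (1/2) ^ α - (3/2) ^ α + (1/2) ^ α) / 2 ^ α := by
      field_simp; ring
    rw [this]
    apply div_pos _ hp
    have h0 : 0 < (1 / 2 - (1/2 : ℝ) ^ α) * (2 ^ α - 1) := mul_pos (by linarith) (by linarith)
    nlinarith
  have hcont : ContinuousAt (fun κ : ℝ => 1 / κ - (cC α (1/2) - cD α (1/2)
      + cD α (1/2) * κ / cC α 1)) 1 := by
    have : ContinuousAt (fun κ : ℝ => 1 / κ) 1 :=
      continuousAt_const.div continuousAt_id (by norm_num)
    refine this.sub ?_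
    fun_prop
  have ev1 : ∀ᶠ κ in nhds (1:ℝ), 0 < 1 / κ - (cC α (1/2) - cD α (1/2)
      + cD α (1/2) * κ / cC α 1) := hcont.eventually (lt_mem_nhds (by linarith))
  have ev2 : ∀ᶠ κ in nhds (1:ℝ), κ < cC α 1 := gt_mem_nhds hC1'
  have ev3 : ∀ᶠ κ in nhds (1:ℝ), κ < cC α (1/2) := gt_mem_nhds (by rw [hC2]; exact e3)
  have ev := (ev1.and (ev2.and ev3)).filter_mono (nhdsWithin_le_nhds (s := Set.Ioi 1))
  obtain ⟨κ, ⟨a1, a2, a3⟩, a4⟩ := (ev.and self_mem_nhdsWithin).exists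
  exact ⟨κ, a4, a2, a3, hDpos, by rw [hC1, hD1], by linarith⟩

/-- separated divergences make the event near the base value rare -/
lemma rare {k n : ℕ} (α : ℝ) (hα : 1 < α) (κ : ℝ) (hκ : 1 < κ) (q : Fin k → ℝ)
    (hq : ∀ i, 0 < q i) (f : (Fin n → Fin k) → ℝ)
    (hf : IsEstimator n α (Real.log κ / (α - 1) / 3) (1/3) q f)
    (w p : Fin k → ℝ) (hw : IsDist w) (hp : IsDist p)
    (hsep : κ * psum α w q ≤ psum α p q ∨ psum α p q ≤ psum α w q / κ) :
    iidProb n p {x | ¬ (Real.log κ / (α - 1) / 3 < |f x - renyiDiv α w q|)} < 1 / 3 := by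
  refine lt_of_le_of_lt (iidProb_mono p hp ?_) (hf p hp)
  have hα1 : 0 < α - 1 := by linarith
  have hl : 0 < Real.log κ / (α - 1) := div_pos (Real.log_pos hκ) hα1
  have hS := psum_pos α p q hp hq
  have hS0 := psum_pos α w q hw hq
  have hd : Real.log κ / (α - 1) ≤ |renyiDiv α p q - renyiDiv α w q| := by
    have e1 : renyiDiv α p q - renyiDiv α w q
        = (Real.log (psum α p q) - Real.log (psum α w q)) / (α - 1) := by
      unfold renyiDiv psum; ring
    rw [e1, abs_div, abs_of_pos hα1]
    refine div_le_div_of_nonneg_right ?_ hα1.le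
    rcases hsep with h | h
    · have := Real.log_le_log (by positivity) h
      rw [Real.log_mul (by positivity) hS0.ne'] at this
      exact le_trans (by linarith) (le_abs_self _)
    · have := Real.log_le_log hS h
      rw [Real.log_div hS0.ne' (by positivity)] at this
      exact le_trans (by linarith) (neg_le_abs _)
  intro x hx
  simp only [Set.mem_ofPred_eq, not_lt] at hx ⊢
  have := abs_sub_le (renyiDiv α p q) (f x) (renyiDiv α w q)
  rw [abs_sub_comm (renyiDiv α p q) (f x)] at this
  linarith

/-- estimating the Rényi divergence always requires
`Ω(√k)` samples. -/
theorem sqrt_lower_bound (α : ℝ) (hα : 1 < α) :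
    ∃ δ₀ c : ℝ, 0 < δ₀ ∧ 0 < c ∧
      ∀ k : ℕ, 2 ≤ k →
      ∀ q : Fin k → ℝ, IsDist q → (∀ i, 0 < q i) →
      ∀ (n : ℕ) (f : (Fin n → Fin k) → ℝ),
        IsEstimator n α δ₀ (1/3) q f →
        c * Real.sqrt k ≤ (n : ℝ) := by
  obtain ⟨κ, hκ, k1, k2, hD, hD1, k3⟩ := exists_kappa α hα
  refine ⟨Real.log κ / (α - 1) / 3, 1 / 5,
    div_pos (div_pos (Real.log_pos hκ) (by linarith)) (by norm_num), by norm_num, ?_⟩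
  intro k hk q _ hq n f hf
  obtain ⟨w, s, g, hg⟩ := exists_good k hk
  have hkR : (0 : ℝ) < k := by exact_mod_cast (by omega : 0 < k)
  have hr : (0 : ℝ) ≤ 3 / k := by positivity
  set E : Set (Fin n → Fin k) := {x | ¬ (Real.log κ / (α - 1) / 3 < |f x - renyiDiv α w q|)}
    with hE
  have hS0 := psum_pos α w q hg.dist hq
  have hPE : 2 / 3 < iidProb n w E := by
    have h1 := hf w hg.dist
    have h2 := iidProb_compl w hg.dist {x | Real.log κ / (α - 1) / 3 < |f x - renyiDiv α w q|}
    have h3 : {x | Real.log κ / (α - 1) / 3 < |f x - renyiDiv α w q|}ᶜ = E := rfl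
    rw [h3] at h2
    linarith
  have d1 : ∀ e, IsDist (pert w s g 1 e) := pert_dist hg 1 (by norm_num) (by norm_num)
  have d2 : ∀ e, IsDist (pert w s g (1/2) e) := pert_dist hg (1/2) (by norm_num) (by norm_num)
  have ps1 : ∀ e, psum α (pert w s g 1 e) q
      = cC α 1 * psum α w q + cC α 1 * Tsum α w s q g e := by
    intro e
    rw [psum_pert hg α 1 (by norm_num) (by norm_num) q e]
    change cC α 1 * _ + cD α 1 * _ = _
    rw [hD1]
  have ps2 : ∀ e, psum α (pert w s g (1/2) e) q
      = cC α (1/2) * psum α w q + cD α (1/2) * Tsum α w s q g e := by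
    intro e
    rw [psum_pert hg α (1/2) (by norm_num) (by norm_num) q e]
    rfl
  have le1 : ∀ p, IsDist p → iidProb n p E ≤ 1 := by
    intro p hp
    have := iidProb_compl p hp E
    have := iidProb_nonneg p hp Eᶜ
    linarith
  have hrare := fun p hp => rare α hα κ hκ q hq f hf w p hg.dist hp
  set F : (Fin k → Bool) → ℝ := fun e =>
    iidProb n (pert w s g 1 e) E + iidProb n (pert w s g (1/2) e) E with hF
  set nt : (Fin k → Bool) → (Fin k → Bool) := fun e i => !(e i) with hnt
  have hinv : Function.Involutive nt := by intro e; funext i; simp [hnt]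
  have four : ∀ e, 0 ≤ Tsum α w s q g e → F e + F (nt e) ≤ 2 := by
    intro e he
    have a1 := hrare _ (d1 e) (Or.inl (by
      rw [ps1]
      have : 0 ≤ cC α 1 * Tsum α w s q g e := mul_nonneg (by linarith) he
      have : κ * psum α w q ≤ cC α 1 * psum α w q := mul_le_mul_of_nonneg_right k1.le hS0.le
      linarith))
    have a2 := hrare _ (d2 e) (Or.inl (by
      rw [ps2]
      have : 0 ≤ cD α (1/2) * Tsum α w s q g e := mul_nonneg hD.le he
      have : κ * psum α w q ≤ cC α (1/2) * psum α w q := mul_le_mul_of_nonneg_right k2.le hS0.le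
      linarith))
    have b1 := le1 _ (d1 (nt e))
    have b2 := le1 _ (d2 (nt e))
    have hT : Tsum α w s q g (nt e) = - Tsum α w s q g e := Tsum_not α w s q g e
    by_cases hc : κ * psum α w q ≤ psum α (pert w s g 1 (nt e)) q
    · have a3 := hrare _ (d1 (nt e)) (Or.inl hc)
      simp only [hF]; linarith
    · have a3 := hrare _ (d2 (nt e)) (Or.inr (by
        rw [ps1, hT] at hc
        rw [ps2, hT]
        push Not at hc
        have hc0 : 0 < cC α 1 := by linarith
        have h1 : psum α w q - Tsum α w s q g e ≤ κ * psum α w q / cC α 1 := by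
          rw [le_div_iff₀ hc0]; linarith
        have h2 := mul_le_mul_of_nonneg_left h1 hD.le
        have h3 := mul_le_mul_of_nonneg_right k3.le hS0.le
        have h4 : (cC α (1/2) - cD α (1/2) + cD α (1/2) * κ / cC α 1) * psum α w q
          = (cC α (1/2) - cD α (1/2)) * psum α w q
            + cD α (1/2) * (κ * psum α w q / cC α 1) := by ring
        have h5 : 1 / κ * psum α w q = psum α w q / κ := by ring
        rw [h4, h5] at h3
        linarith))
      simp only [hF]; linarith
  have four' : ∀ e, F e + F (nt e) ≤ 2 := by
    intro e
    rcases le_total 0 (Tsum α w s q g e) with h | h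
    · exact four e h
    · have := four (nt e) (by
        have hT : Tsum α w s q g (nt e) = - Tsum α w s q g e := Tsum_not α w s q g e
        linarith)
      rw [hinv e] at this
      linarith
  have hsum : 2 * ∑ e, F e ≤ 2 ^ k * 2 := by
    have h1 : ∑ e, F (nt e) = ∑ e, F e := Equiv.sum_comp hinv.toPerm F
    calc 2 * ∑ e, F e = ∑ e, (F e + F (nt e)) := by
          have h2 : ∑ e, (F e + F (nt e)) = ∑ e, F e + ∑ e, F (nt e) :=
            Finset.sum_add_distrib (f := F) (g := fun e => F (nt e))
          rw [h2, h1]; ring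
      _ ≤ ∑ e : Fin k → Bool, (2 : ℝ) := Finset.sum_le_sum fun e _ => four' e
      _ = 2 ^ k * 2 := by simp
  have m1 := mix_lower (n := n) hg hr 1 (by norm_num) (by norm_num) E
  have m2 := mix_lower (n := n) hg hr (1/2) (by norm_num) (by norm_num) E
  have hFs : ∑ e, F e = ∑ e, iidProb n (pert w s g 1 e) E
      + ∑ e, iidProb n (pert w s g (1/2) e) E := Finset.sum_add_distrib
  have hfin : 2 * (iidProb n w E - (n : ℝ) ^ 2 * (3 / k)) ≤ 1 := by
    have hp : (0 : ℝ) < 2 ^ k := by positivity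
    by_contra! hcon
    have := mul_lt_mul_of_pos_left hcon hp
    linarith
  have hn : (k : ℝ) ≤ 18 * (n : ℝ) ^ 2 := by
    have h1 : 1 / 6 ≤ (n : ℝ) ^ 2 * (3 / k) := by linarith
    have h2 := mul_le_mul_of_nonneg_right h1 hkR.le
    have h3 : (n : ℝ) ^ 2 * (3 / k) * k = 3 * (n : ℝ) ^ 2 := by field_simp
    linarith
  have hs : Real.sqrt k ≤ 5 * n := by
    rw [Real.sqrt_le_left (by positivity)]
    nlinarith [sq_nonneg (n : ℝ)]
  linarith
end
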